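/- Killing tensors of the free spin-3 theory (characterization of global reducibility parameters underlying Proposition 5): let λ : ℝⁿ → ℝ^{n²} be a smooth map with λ_{μν}(x) symmetric and traceless (η^{μν}λ_{μν}(x) = 0 for all x). Then λ satisfies the Killing equation ∂_μ λ_{νρ} + ∂_ν λ_{ρμ} + ∂_ρ λ_{μν} = 0 identically on ℝⁿ if and only if there exist constant tensors λ⁰_{μν}, A_{μν|ρ}, B_{μν|ρσ} such that λ_{μν}(x) = λ⁰_{μν} + A_{μν|ρ} x^ρ + B_{μν|ρσ} x^ρ x^σ for all x, where: λ⁰ is symmetric and η-traceless; A is symmetric and η-traceless in (μ,ν) and satisfies the cyclic identity A_{μν|ρ} + A_{νρ|μ} + A_{ρμ|ν} = 0; and B is symmetric in (μ,ν), symmetric in (ρ,σ), η-traceless in (μ,ν) (η^{μν}B_{μν|ρσ} = 0), and satisfies B_{μν|ρσ} + B_{νρ|μσ} + B_{ρμ|νσ} = 0 for all σ. -/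

import Mathlib

open MeasureTheory

noncomputable section

/-- Mostly-plus Minkowski metric `η_{μν} = diag(−1,+1,…,+1)` on `ℝⁿ`
(it coincides with its inverse `η^{μν}`). -/
def eta (n : ℕ) (μ ν : Fin n) : ℝ :=
  if μ = ν then (if (μ : ℕ) = 0 then -1 else 1) else 0

/-- Partial derivative `∂_μ` of a scalar function on `ℝⁿ`. -/
def pd {n : ℕ} (μ : Fin n) (f : (Fin n → ℝ) → ℝ) : (Fin n → ℝ) → ℝ :=
  fun x => fderiv ℝ f x (Pi.single μ 1)

/-- A rank-3 covariant tensor field on `ℝⁿ` (the type of spin-3 fields). -/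
abbrev Spin3 (n : ℕ) := (Fin n → ℝ) → Fin n → Fin n → Fin n → ℝ

/-- Trace `h_μ := η^{νρ} h_{μνρ}`. -/
def trH {n : ℕ} (h : Spin3 n) (x : Fin n → ℝ) (μ : Fin n) : ℝ :=
  ∑ ν, ∑ ρ, eta n ν ρ * h x μ ν ρ

/-- Fronsdal tensor
`F_{μνρ} := □h_{μνρ} − ∂^σ(∂_μ h_{νρσ} + ∂_ν h_{ρμσ} + ∂_ρ h_{μνσ})
  + ∂_μ∂_ν h_ρ + ∂_ν∂_ρ h_μ + ∂_ρ∂_μ h_ν`. -/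
def fronsdal {n : ℕ} (h : Spin3 n) (x : Fin n → ℝ) (μ ν ρ : Fin n) : ℝ :=
  (∑ σ, ∑ τ, eta n σ τ * pd σ (pd τ (fun y => h y μ ν ρ)) x)
  - (∑ σ, ∑ τ, eta n σ τ *
      pd τ (fun y => pd μ (fun z => h z ν ρ σ) y + pd ν (fun z => h z ρ μ σ) y
        + pd ρ (fun z => h z μ ν σ) y) x)
  + pd μ (pd ν (fun z => trH h z ρ)) x
  + pd ν (pd ρ (fun z => trH h z μ)) x
  + pd ρ (pd μ (fun z => trH h z ν)) x

/-- Trace of the Fronsdal tensor, `F_ρ := η^{μν} F_{μνρ}`. -/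
def trF {n : ℕ} (h : Spin3 n) (x : Fin n → ℝ) (ρ : Fin n) : ℝ :=
  ∑ μ, ∑ ν, eta n μ ν * fronsdal h x μ ν ρ

/-- Einstein tensor `G_{μνρ} := F_{μνρ} − (1/2)(η_{μν}F_ρ + η_{νρ}F_μ + η_{ρμ}F_ν)`. -/
def einstein {n : ℕ} (h : Spin3 n) (x : Fin n → ℝ) (μ ν ρ : Fin n) : ℝ :=
  fronsdal h x μ ν ρ
    - (1/2) * (eta n μ ν * trF h x ρ + eta n ν ρ * trF h x μ + eta n ρ μ * trF h x ν)

/-- Gauge transformation `(δ_λ h)_{μνρ} := ∂_μ λ_{νρ} + ∂_ν λ_{ρμ} + ∂_ρ λ_{μν}`. -/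
def gaugeTransform {n : ℕ} (lam : (Fin n → ℝ) → Fin n → Fin n → ℝ) : Spin3 n :=
  fun x μ ν ρ => pd μ (fun y => lam y ν ρ) x + pd ν (fun y => lam y ρ μ) x
    + pd ρ (fun y => lam y μ ν) x

/-- Curvature tensor `K_{αμ|βν|γρ}`: the antisymmetrization of `∂_α∂_β∂_γ h_{μνρ}`
in each of the index pairs `(α,μ)`, `(β,ν)`, `(γ,ρ)`. -/
def curvature {n : ℕ} (h : Spin3 n) (x : Fin n → ℝ) (α μ β ν γ ρ : Fin n) : ℝ :=
  pd α (pd β (pd γ (fun y => h y μ ν ρ))) x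
  - pd μ (pd β (pd γ (fun y => h y α ν ρ))) x
  - pd α (pd ν (pd γ (fun y => h y μ β ρ))) x
  - pd α (pd β (pd ρ (fun y => h y μ ν γ))) x
  + pd μ (pd ν (pd γ (fun y => h y α β ρ))) x
  + pd μ (pd β (pd ρ (fun y => h y α ν γ))) x
  + pd α (pd ν (pd ρ (fun y => h y μ β γ))) x
  - pd μ (pd ν (pd ρ (fun y => h y α β γ))) x

/-- The free Fronsdal Lagrangian density for a single spin-3 field (all
contractions performed with the Minkowski metric `η`). -/
def lag {n : ℕ} (h : Spin3 n) (x : Fin n → ℝ) : ℝ :=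
  -(1/2) * (∑ σ, ∑ τ, ∑ μ, ∑ μ', ∑ ν, ∑ ν', ∑ ρ, ∑ ρ',
      eta n σ τ * eta n μ μ' * eta n ν ν' * eta n ρ ρ' *
        pd σ (fun y => h y μ ν ρ) x * pd τ (fun y => h y μ' ν' ρ') x)
  + (3/2) * (∑ μ, ∑ μ', ∑ ν, ∑ ν', ∑ ρ, ∑ ρ', ∑ σ, ∑ σ',
      eta n μ μ' * eta n ν ν' * eta n ρ ρ' * eta n σ σ' *
        pd μ' (fun y => h y μ ρ σ) x * pd ν (fun y => h y ν' ρ' σ') x)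
  + (3/2) * (∑ μ, ∑ μ', ∑ ν, ∑ ν',
      eta n μ μ' * eta n ν ν' * pd μ (fun y => trH h y ν) x * pd μ' (fun y => trH h y ν') x)
  + (3/4) * (∑ μ, ∑ μ', ∑ ν, ∑ ν',
      eta n μ μ' * eta n ν ν' * pd μ (fun y => trH h y μ') x * pd ν (fun y => trH h y ν') x)
  - 3 * (∑ μ, ∑ μ', ∑ ν, ∑ ν', ∑ ρ, ∑ ρ',
      eta n μ μ' * eta n ν ν' * eta n ρ ρ' *
        pd μ (fun y => trH h y ν) x * pd ρ (fun y => h y ρ' μ' ν') x)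

/-- The free spin-3 (Fronsdal) action for a single field. -/
def action {n : ℕ} (h : Spin3 n) : ℝ := ∫ x : Fin n → ℝ, lag h x

lemma contDiff_pd {n : ℕ} (μ : Fin n) {f : (Fin n → ℝ) → ℝ} (hf : ContDiff ℝ (⊤ : ℕ∞) f) :
    ContDiff ℝ (⊤ : ℕ∞) (pd μ f) :=
  (hf.fderiv_right (m := ((⊤ : ℕ∞) : WithTop ℕ∞)) (by simp)).clm_apply contDiff_const

lemma differentiable_of_contDiff_top {n : ℕ} {f : (Fin n → ℝ) → ℝ}
    (hf : ContDiff ℝ (⊤ : ℕ∞) f) : Differentiable ℝ f :=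
  hf.differentiable (by simp)

lemma pd_comm {n : ℕ} (μ ν : Fin n) {f : (Fin n → ℝ) → ℝ} (hf : ContDiff ℝ (⊤ : ℕ∞) f) :
    pd μ (pd ν f) = pd ν (pd μ f) := by
  have hd : Differentiable ℝ (fderiv ℝ f) :=
    (hf.fderiv_right (m := ((⊤ : ℕ∞) : WithTop ℕ∞)) (by simp)).differentiable (by simp)
  have key : ∀ (α β : Fin n) (x : Fin n → ℝ),
      pd α (pd β f) x = fderiv ℝ (fderiv ℝ f) x (Pi.single α 1) (Pi.single β 1) := by
    intro α β x
    unfold pd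
    rw [fderiv_clm_apply (hd x) (differentiableAt_const _)]
    simp
  funext x
  rw [key, key]
  have hs : IsSymmSndFDerivAt ℝ f x :=
    hf.contDiffAt.isSymmSndFDerivAt <| by
      rw [minSmoothness_of_isRCLikeNormedField]
      exact WithTop.coe_le_coe.2 le_top
  exact hs _ _

lemma pd_zero {n : ℕ} (μ : Fin n) : pd μ (fun _ => 0) = fun _ => 0 := by
  funext x
  simp [pd]

lemma pd_add {n : ℕ} (μ : Fin n) {f g : (Fin n → ℝ) → ℝ} (hf : ContDiff ℝ (⊤ : ℕ∞) f)
    (hg : ContDiff ℝ (⊤ : ℕ∞) g) :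
    pd μ (fun x => f x + g x) = fun x => pd μ f x + pd μ g x := by
  funext x
  unfold pd
  rw [fderiv_fun_add (differentiable_of_contDiff_top hf x) (differentiable_of_contDiff_top hg x)]
  simp

/-- The polynomial `c + a_ρ x^ρ + b_{ρσ} x^ρ x^σ`. -/
def quadPoly {n : ℕ} (c : ℝ) (a : Fin n → ℝ) (b : Fin n → Fin n → ℝ) (x : Fin n → ℝ) : ℝ :=
  c + (∑ ρ, a ρ * x ρ) + ∑ ρ, ∑ σ, b ρ σ * x ρ * x σ

lemma differentiable_quadPoly {n : ℕ} (c : ℝ) (a : Fin n → ℝ) (b : Fin n → Fin n → ℝ) :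
    Differentiable ℝ (quadPoly c a b) := by
  unfold quadPoly
  fun_prop

lemma pd_quadPoly {n : ℕ} (c : ℝ) (a : Fin n → ℝ) (b : Fin n → Fin n → ℝ)
    (hb : ∀ ρ σ, b ρ σ = b σ ρ) (μ : Fin n) (x : Fin n → ℝ) :
    pd μ (quadPoly c a b) x = a μ + ∑ σ, 2 * b μ σ * x σ := by
  have hx : ∀ ρ : Fin n, HasFDerivAt (fun y : Fin n → ℝ => y ρ)
      (ContinuousLinearMap.proj (R := ℝ) (φ := fun _ : Fin n => ℝ) ρ) x :=
    fun ρ => hasFDerivAt_apply ρ x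
  have h := ((HasFDerivAt.fun_sum (u := Finset.univ) fun ρ _ => (hx ρ).const_mul (a ρ)).const_add
    c).fun_add (HasFDerivAt.fun_sum (u := Finset.univ) fun ρ _ =>
      HasFDerivAt.fun_sum (u := Finset.univ) fun σ _ =>
        ((hx ρ).const_mul (b ρ σ)).fun_mul (hx σ))
  have h' : fderiv ℝ (quadPoly c a b) x = _ := h.fderiv
  unfold pd
  rw [h']
  simp only [add_apply, sum_apply,
    smul_apply, ContinuousLinearMap.proj_apply, smul_eq_mul,
    Pi.single_apply, Finset.sum_add_distrib, mul_ite, mul_one, mul_zero,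
    Finset.sum_ite_eq', Finset.mem_univ, if_true]
  rw [Finset.sum_comm]
  simp only [Finset.sum_ite_eq', Finset.mem_univ, if_true]
  rw [← Finset.sum_add_distrib]
  congr 1
  refine Finset.sum_congr rfl fun σ _ => ?_
  rw [hb σ μ]
  ring

lemma eq_of_pd_eq {n : ℕ} {f g : (Fin n → ℝ) → ℝ} (hf : Differentiable ℝ f)
    (hg : Differentiable ℝ g) (h : ∀ μ x, pd μ f x = pd μ g x) (h0 : f 0 = g 0) : f = g := by
  refine eq_of_fderiv_eq (𝕜 := ℝ) hf hg (fun x => ?_) 0 h0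
  refine ContinuousLinearMap.coe_injective ((Pi.basisFun ℝ (Fin n)).ext fun μ => ?_)
  simpa [pd] using h μ x

/-- A smooth function with vanishing third derivatives is its second order Taylor polynomial. -/
lemma eq_quadPoly_of_pd_pd_pd_eq_zero {n : ℕ} {f : (Fin n → ℝ) → ℝ}
    (hf : ContDiff ℝ (⊤ : ℕ∞) f) (h : ∀ α β γ x, pd α (pd β (pd γ f)) x = 0) :
    f = quadPoly (f 0) (fun ρ => pd ρ f 0) (fun ρ σ => pd ρ (pd σ f) 0 / 2) := by
  have h2 : ∀ β γ x, pd β (pd γ f) x = pd β (pd γ f) 0 := by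
    intro β γ x
    have hc : pd β (pd γ f) = quadPoly (pd β (pd γ f) 0) 0 0 := by
      refine eq_of_pd_eq (differentiable_of_contDiff_top (contDiff_pd β (contDiff_pd γ hf)))
        (differentiable_quadPoly _ _ _) (fun μ y => ?_) (by simp [quadPoly])
      rw [h, pd_quadPoly _ _ _ (fun _ _ => rfl)]
      simp
    rw [hc]
    simp [quadPoly]
  have h1 : ∀ γ, pd γ f = quadPoly (pd γ f 0) (fun ρ => pd ρ (pd γ f) 0) 0 := by
    intro γ
    refine eq_of_pd_eq (differentiable_of_contDiff_top (contDiff_pd γ hf))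
      (differentiable_quadPoly _ _ _) (fun μ y => ?_) (by simp [quadPoly])
    rw [h2, pd_quadPoly _ _ _ (fun _ _ => rfl)]
    simp
  refine eq_of_pd_eq (differentiable_of_contDiff_top hf)
    (differentiable_quadPoly _ _ _) (fun μ y => ?_) (by simp [quadPoly])
  rw [pd_quadPoly _ _ _ (fun ρ σ => by rw [pd_comm ρ σ hf]), congrFun (h1 μ) y]
  simp only [quadPoly, Pi.zero_apply, zero_mul, Finset.sum_const_zero, add_zero]
  congr 1
  refine Finset.sum_congr rfl fun σ _ => ?_
  rw [pd_comm σ μ hf]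
  ring

lemma linear_coeff_eq_zero {n : ℕ} {c : ℝ} {a : Fin n → ℝ}
    (h : ∀ x : Fin n → ℝ, c + ∑ ρ, a ρ * x ρ = 0) : c = 0 ∧ ∀ ρ, a ρ = 0 := by
  have hc : c = 0 := by simpa using h 0
  exact ⟨hc, fun ρ => by simpa [hc, Pi.single_apply] using h (Pi.single ρ 1)⟩

lemma quadPoly_coeff_eq_zero {n : ℕ} {c : ℝ} {a : Fin n → ℝ} {b : Fin n → Fin n → ℝ}
    (hb : ∀ ρ σ, b ρ σ = b σ ρ) (h : ∀ x, quadPoly c a b x = 0) :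
    c = 0 ∧ (∀ ρ, a ρ = 0) ∧ ∀ ρ σ, b ρ σ = 0 := by
  have hz : quadPoly c a b = fun _ => 0 := funext h
  have hd : ∀ μ, a μ = 0 ∧ ∀ σ, 2 * b μ σ = 0 := fun μ =>
    linear_coeff_eq_zero fun x => by
      rw [← pd_quadPoly c a b hb μ x, hz]
      simp [pd]
  exact ⟨by simpa [quadPoly] using h 0, fun ρ => (hd ρ).1,
    fun ρ σ => by simpa using (hd ρ).2 σ⟩

/-- A rank-5 tensor symmetric in its first three and in its last two indices vanishes if its
symmetrization over the last three indices does. -/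
lemma eq_zero_of_symm_of_cyclic {ι : Type*} {T : ι → ι → ι → ι → ι → ℝ}
    (h12 : ∀ a b c d e, T a b c d e = T b a c d e)
    (h23 : ∀ a b c d e, T a b c d e = T a c b d e)
    (h45 : ∀ a b c d e, T a b c d e = T a b c e d)
    (hcyc : ∀ a b c d e, T a b c d e + T a b d e c + T a b e c d = 0)
    (a b c d e : ι) : T a b c d e = 0 := by
  have e1 := hcyc a b c d e
  have e2 := hcyc a c b d e
  have e3 := hcyc a d b c e
  have e4 := hcyc a e b c d
  have e5 := hcyc b c a d e
  have e6 := hcyc b d a c e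
  have e7 := hcyc b e a c d
  have e8 := hcyc c d a b e
  have e9 := hcyc c e a b d
  have e10 := hcyc d e a b c
  grind

lemma pd_pd_pd_eq_zero_of_killing {n : ℕ} {lam : (Fin n → ℝ) → Fin n → Fin n → ℝ}
    (lsmooth : ∀ μ ν : Fin n, ContDiff ℝ (⊤ : ℕ∞) fun x => lam x μ ν)
    (lsym : ∀ x μ ν, lam x μ ν = lam x ν μ)
    (hK : ∀ x μ ν ρ, pd μ (fun y => lam y ν ρ) x + pd ν (fun y => lam y ρ μ) x
        + pd ρ (fun y => lam y μ ν) x = 0) (α β γ μ ν : Fin n) (x : Fin n → ℝ) :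
    pd α (pd β (pd γ fun y => lam y μ ν)) x = 0 := by
  refine eq_zero_of_symm_of_cyclic (T := fun α β γ μ ν => pd α (pd β (pd γ fun y => lam y μ ν)) x)
    ?_ ?_ ?_ ?_ α β γ μ ν
  · intro a b c d e
    simp only [pd_comm a b (contDiff_pd c (lsmooth d e))]
  · intro a b c d e
    simp only [pd_comm b c (lsmooth d e)]
  · intro a b c d e
    simp only [fun y => lsym y d e]
  · intro a b c d e
    have h1 := contDiff_pd c (lsmooth d e)
    have h2 := contDiff_pd d (lsmooth e c)
    have h3 := contDiff_pd e (lsmooth c d)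
    have hz : (fun y => pd c (fun z => lam z d e) y + pd d (fun z => lam z e c) y
        + pd e (fun z => lam z c d) y) = fun _ => 0 := funext fun y => hK y c d e
    have hab := congrArg (fun f => pd a (pd b f) x) hz
    simp only [pd_add b (h1.add h2) h3, pd_add b h1 h2,
      pd_add a ((contDiff_pd b h1).add (contDiff_pd b h2)) (contDiff_pd b h3),
      pd_add a (contDiff_pd b h1) (contDiff_pd b h2), pd_zero] at hab
    exact hab

/-- **Killing tensors of the free spin-3 theory.**  A smooth symmetric
`η`-traceless parameter `λ` satisfies the Killing equation
`∂_μ λ_{νρ} + ∂_ν λ_{ρμ} + ∂_ρ λ_{μν} = 0` if and only if it is a polynomial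
`λ_{μν}(x) = λ⁰_{μν} + A_{μν|ρ} x^ρ + B_{μν|ρσ} x^ρ x^σ` with constant tensors
`λ⁰`, `A`, `B` having the stated algebraic (symmetry, trace and cyclic)
properties. -/
theorem killing_tensors_characterization (n : ℕ) (hn : 1 ≤ n)
    (lam : (Fin n → ℝ) → Fin n → Fin n → ℝ)
    (lsmooth : ∀ μ ν : Fin n, ContDiff ℝ (⊤ : ℕ∞) fun x => lam x μ ν)
    (lsym : ∀ x μ ν, lam x μ ν = lam x ν μ)
    (ltraceless : ∀ x, ∑ μ, ∑ ν, eta n μ ν * lam x μ ν = 0) :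
    (∀ x μ ν ρ, pd μ (fun y => lam y ν ρ) x + pd ν (fun y => lam y ρ μ) x
        + pd ρ (fun y => lam y μ ν) x = 0) ↔
    (∃ (lam0 : Fin n → Fin n → ℝ) (A : Fin n → Fin n → Fin n → ℝ)
        (B : Fin n → Fin n → Fin n → Fin n → ℝ),
      (∀ μ ν, lam0 μ ν = lam0 ν μ) ∧
      (∑ μ, ∑ ν, eta n μ ν * lam0 μ ν = 0) ∧
      (∀ μ ν ρ, A μ ν ρ = A ν μ ρ) ∧
      (∀ ρ, ∑ μ, ∑ ν, eta n μ ν * A μ ν ρ = 0) ∧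
      (∀ μ ν ρ, A μ ν ρ + A ν ρ μ + A ρ μ ν = 0) ∧
      (∀ μ ν ρ σ, B μ ν ρ σ = B ν μ ρ σ) ∧
      (∀ μ ν ρ σ, B μ ν ρ σ = B μ ν σ ρ) ∧
      (∀ ρ σ, ∑ μ, ∑ ν, eta n μ ν * B μ ν ρ σ = 0) ∧
      (∀ μ ν ρ σ, B μ ν ρ σ + B ν ρ μ σ + B ρ μ ν σ = 0) ∧
      (∀ x μ ν, lam x μ ν = lam0 μ ν + (∑ ρ, A μ ν ρ * x ρ)
        + ∑ ρ, ∑ σ, B μ ν ρ σ * x ρ * x σ)) := by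
  constructor
  · intro hK
    set A : Fin n → Fin n → Fin n → ℝ := fun μ ν ρ => pd ρ (fun y => lam y μ ν) 0 with hA
    set B : Fin n → Fin n → Fin n → Fin n → ℝ :=
      fun μ ν ρ σ => pd ρ (pd σ fun y => lam y μ ν) 0 / 2 with hB
    have hpoly : ∀ μ ν, (fun y => lam y μ ν) = quadPoly (lam 0 μ ν) (A μ ν) (B μ ν) :=
      fun μ ν => eq_quadPoly_of_pd_pd_pd_eq_zero (lsmooth μ ν) fun α β γ x =>
        pd_pd_pd_eq_zero_of_killing lsmooth lsym hK α β γ μ ν x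
    have hBsymm : ∀ μ ν ρ σ, B μ ν ρ σ = B μ ν σ ρ := fun μ ν ρ σ => by
      simp only [hB, pd_comm ρ σ (lsmooth μ ν)]
    have htr : ∀ x, quadPoly (∑ μ, ∑ ν, eta n μ ν * lam 0 μ ν)
        (fun ρ => ∑ μ, ∑ ν, eta n μ ν * A μ ν ρ)
        (fun ρ σ => ∑ μ, ∑ ν, eta n μ ν * B μ ν ρ σ) x = 0 := by
      intro x
      rw [← ltraceless x]
      have hsum : ∀ μ ν, eta n μ ν * lam x μ ν = eta n μ ν * lam 0 μ ν
          + (∑ ρ, eta n μ ν * A μ ν ρ * x ρ)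
          + ∑ ρ, ∑ σ, eta n μ ν * B μ ν ρ σ * x ρ * x σ := by
        intro μ ν
        rw [show lam x μ ν = _ from congrFun (hpoly μ ν) x]
        simp only [quadPoly, mul_add, Finset.mul_sum, mul_assoc]
      simp only [hsum, quadPoly, Finset.sum_add_distrib, Finset.sum_mul]
      congr 1
      · congr 1
        rw [Finset.sum_comm]
        exact Finset.sum_congr rfl fun μ _ => Finset.sum_comm
      · calc _ = ∑ ρ, ∑ μ, ∑ ν, ∑ σ, eta n μ ν * B μ ν ρ σ * x ρ * x σ := by
              refine Finset.sum_congr rfl fun ρ _ => ?_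
              rw [Finset.sum_comm]
              exact Finset.sum_congr rfl fun μ _ => Finset.sum_comm
          _ = _ := by
              rw [Finset.sum_comm]
              exact Finset.sum_congr rfl fun μ _ => Finset.sum_comm
    obtain ⟨-, hAtr, hBtr⟩ := quadPoly_coeff_eq_zero
      (fun ρ σ => by simp only [hBsymm _ _ ρ σ]) htr
    have hcyc : ∀ μ ν ρ, A μ ν ρ + A ν ρ μ + A ρ μ ν = 0 ∧ ∀ σ,
        2 * (B μ ν ρ σ + B ν ρ μ σ + B ρ μ ν σ) = 0 := by
      refine fun μ ν ρ => linear_coeff_eq_zero fun x => ?_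
      have h := hK x ρ μ ν
      rw [hpoly μ ν, hpoly ν ρ, hpoly ρ μ, pd_quadPoly _ _ _ (hBsymm μ ν),
        pd_quadPoly _ _ _ (hBsymm ν ρ), pd_quadPoly _ _ _ (hBsymm ρ μ)] at h
      simp only [mul_add, add_mul, Finset.sum_add_distrib]
      linarith
    refine ⟨lam 0, A, B, lsym 0, ltraceless 0, fun μ ν ρ => ?_, hAtr, fun μ ν ρ => (hcyc μ ν ρ).1,
      fun μ ν ρ σ => ?_, hBsymm, hBtr, fun μ ν ρ σ => by simpa using (hcyc μ ν ρ).2 σ,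
      fun x μ ν => congrFun (hpoly μ ν) x⟩
    · simp only [hA, fun y => lsym y μ ν]
    · simp only [hB, fun y => lsym y μ ν]
  · rintro ⟨lam0, A, B, -, -, -, -, hAcyc, -, hBsymm, -, hBcyc, hlam⟩ x μ ν ρ
    have hpoly : ∀ μ ν, (fun y => lam y μ ν) = quadPoly (lam0 μ ν) (A μ ν) (B μ ν) :=
      fun μ ν => funext fun y => hlam y μ ν
    rw [hpoly μ ν, hpoly ν ρ, hpoly ρ μ, pd_quadPoly _ _ _ (hBsymm μ ν),
      pd_quadPoly _ _ _ (hBsymm ν ρ), pd_quadPoly _ _ _ (hBsymm ρ μ)]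
    have hsum : (∑ σ, 2 * B μ ν ρ σ * x σ) + (∑ σ, 2 * B ν ρ μ σ * x σ)
        + ∑ σ, 2 * B ρ μ ν σ * x σ = 0 := by
      rw [← Finset.sum_add_distrib, ← Finset.sum_add_distrib]
      refine Finset.sum_eq_zero fun σ _ => ?_
      linear_combination 2 * x σ * hBcyc μ ν ρ σ
    linarith [hAcyc μ ν ρ]
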